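/- Let X be a right A-Galois object and θ_X(x) = ε(σ⁻¹(x₍₁₎))·σ_X(x₍₀₎). Writing β(a) = a^[1] ⊗ a^[2], for all a ∈ A and x ∈ X: (i) β(S(a)) = (θ_X ⊗ id)(Σ(β(a))), i.e. S(a)^[1] ⊗ S(a)^[2] = θ_X(a^[2]) ⊗ a^[1], where Σ is the flip on X ⊗ X; (ii) x₍₁₎^[1]·θ_X(x₍₀₎) ⊗ x₍₁₎^[2] = 1 ⊗ x in X ⊗ X; (iii) θ_X(a^[2])·a^[1] = ε(a)·1 in X; (iv) β(S²(a)) = (θ_X ⊗ θ_X)(β(a)). -/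

import Mathlib

open TensorProduct

noncomputable section

variable (k : Type*) [Field k]

/-- Apply a linear functional to the second tensor factor. -/
def applySnd {M N : Type*} [AddCommGroup M] [Module k M]
    [AddCommGroup N] [Module k N] (f : N →ₗ[k] k) : M ⊗[k] N →ₗ[k] M :=
  (TensorProduct.rid k M).toLinearMap ∘ₗ LinearMap.lTensor M f

/-- Apply a linear functional to the first tensor factor. -/
def applyFst {M N : Type*} [AddCommGroup M] [Module k M]
    [AddCommGroup N] [Module k N] (f : M →ₗ[k] k) : M ⊗[k] N →ₗ[k] N :=
  (TensorProduct.lid k N).toLinearMap ∘ₗ LinearMap.rTensor N f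

variable (A X : Type*) [Ring A] [HopfAlgebra k A] [Ring X] [Algebra k X]

/-- The Galois map `V : X ⊗ X → X ⊗ A`, `x ⊗ y ↦ (x ⊗ 1) * α y`. -/
def galoisV (α : X →ₐ[k] X ⊗[k] A) : X ⊗[k] X →ₗ[k] X ⊗[k] A :=
  LinearMap.mul' k (X ⊗[k] A) ∘ₗ
    TensorProduct.map ((TensorProduct.mk k X A).flip 1) α.toLinearMap

/-- A Hopf algebra with bijective antipode and faithful left integral `φ`,
together with a right Galois coaction `α` on `X` with trivial coinvariants. -/
structure GaloisContext where
  φ : A →ₗ[k] k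
  φ_ne : φ ≠ 0
  φ_integral : ∀ a : A, applySnd k φ (Coalgebra.comul a) = φ a • (1 : A)
  φ_faithful_left : ∀ a : A, (∀ b : A, φ (a * b) = 0) → a = 0
  φ_faithful_right : ∀ a : A, (∀ b : A, φ (b * a) = 0) → a = 0
  antipode_bijective : Function.Bijective (HopfAlgebra.antipode (R := k) (A := A))
  α : X →ₐ[k] X ⊗[k] A
  coassoc : ∀ x : X,
    TensorProduct.assoc k X A A ((LinearMap.rTensor A α.toLinearMap) (α x))
      = LinearMap.lTensor X (Coalgebra.comul (R := k) (A := A)) (α x)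
  counit_id : ∀ x : X,
    applySnd k (Coalgebra.counit (R := k) (A := A)) (α x) = x
  coinv_trivial : ∀ x : X, α x = x ⊗ₜ[k] (1 : A) → ∃ c : k, x = c • (1 : X)
  galois : Function.Bijective (galoisV k A X α)

variable {k A X}

/-- The Galois map as a linear equivalence. -/
def GaloisContext.V (G : GaloisContext k A X) : (X ⊗[k] X) ≃ₗ[k] (X ⊗[k] A) :=
  LinearEquiv.ofBijective (galoisV k A X G.α) G.galois

/-- The map `β : A → X ⊗ X`, `a ↦ V⁻¹(1 ⊗ a)`. -/
def GaloisContext.β (G : GaloisContext k A X) : A →ₗ[k] X ⊗[k] X :=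
  G.V.symm.toLinearMap ∘ₗ TensorProduct.mk k X A 1

end
/-- The analogue `θ_X` of the square of the antipode on a Galois object:
`θ_X(x) = ε(σ⁻¹(x₍₁₎)) • σ_X(x₍₀₎)`. -/
noncomputable def thetaX {k : Type*} [Field k] {A X : Type*} [Ring A] [HopfAlgebra k A]
    [Ring X] [Algebra k X] (G : GaloisContext k A X) (σ : A ≃ₐ[k] A) (σX : X ≃ₐ[k] X) :
    X →ₗ[k] X :=
  σX.toLinearMap ∘ₗ
    applySnd k ((Coalgebra.counit (R := k) (A := A)) ∘ₗ σ.symm.toLinearMap) ∘ₗ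
      G.α.toLinearMap

section Helpers

open WithConv Coalgebra

variable {k : Type*} [Field k] {A X : Type*} [Ring A] [HopfAlgebra k A] [Ring X] [Algebra k X]

local notation "S" => HopfAlgebra.antipode k (A := A)

/-- `(1 ⊗ a₁) Δ(S a₂) = S a ⊗ 1`. -/
noncomputable def hMap (k A : Type*) [Field k] [Ring A] [HopfAlgebra k A] : A ⊗[k] A →ₗ[k] A ⊗[k] A :=
  LinearMap.mul' k (A ⊗[k] A) ∘ₗ
    TensorProduct.map (TensorProduct.mk k A A 1)
      (comul ∘ₗ HopfAlgebra.antipode k (A := A))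

lemma hMap_comul (a : A) : hMap k A (comul a) = S a ⊗ₜ[k] 1 := by
  let i1 : A →ₐ[k] A ⊗[k] A := Algebra.TensorProduct.includeLeft
  let i2 : A →ₐ[k] A ⊗[k] A := Algebra.TensorProduct.includeRight
  have h1 : toConv i1.toLinearMap * toConv i2.toLinearMap
      = toConv (comul : A →ₗ[k] A ⊗[k] A) := by
    ext a
    rw [LinearMap.convMul_apply]
    simp only
    generalize (comul a : A ⊗[k] A) = t
    induction t with
    | zero => simp
    | tmul x y => simp [i1, i2]
    | add x y hx hy => simp only [map_add, hx, hy]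
  have h2 : toConv (i1.toLinearMap ∘ₗ S) * toConv i1.toLinearMap = 1 := by
    have := LinearMap.algHom_comp_convMul_distrib i1 (toConv S) (toConv LinearMap.id)
    rw [LinearMap.antipode_mul_id] at this
    simp only [LinearMap.comp_id] at this
    apply WithConv.ofConv_injective
    rw [← this]
    ext a
    simp [i1, Algebra.algebraMap_eq_smul_one, Algebra.TensorProduct.one_def, smul_tmul']
  have h3 := LinearMap.comul_right_inv (R := k) (C := A)
  have h4 : toConv i2.toLinearMap * toConv ((comul : A →ₗ[k] A ⊗[k] A) ∘ₗ S)
      = toConv (i1.toLinearMap ∘ₗ S) := by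
    rw [← h1, mul_assoc] at h3
    calc _ = (toConv (i1.toLinearMap ∘ₗ S) * toConv i1.toLinearMap) *
          (toConv i2.toLinearMap * toConv ((comul : A →ₗ[k] A ⊗[k] A) ∘ₗ S)) := by
            rw [h2, one_mul]
      _ = _ := by rw [mul_assoc, h3, mul_one]
  have h5 := congrArg (fun f => f.ofConv a) h4
  exact h5

lemma tensor_eq_of_applyFst {M N : Type*} [AddCommGroup M] [Module k M]
    [AddCommGroup N] [Module k N] {u v : M ⊗[k] N}
    (h : ∀ f : M →ₗ[k] k, applyFst k f u = applyFst k f v) : u = v := by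
  classical
  let b := Module.Basis.ofVectorSpace k M
  apply (TensorProduct.equivFinsuppOfBasisLeft (N := N) b).injective
  ext i
  rw [TensorProduct.equivFinsuppOfBasisLeft_apply, TensorProduct.equivFinsuppOfBasisLeft_apply]
  exact h (b.coord i)

@[simp] lemma applySnd_tmul {M N : Type*} [AddCommGroup M] [Module k M]
    [AddCommGroup N] [Module k N] (f : N →ₗ[k] k) (m : M) (n : N) :
    applySnd k f (m ⊗ₜ[k] n) = f n • m := by simp [applySnd]

@[simp] lemma applyFst_tmul {M N : Type*} [AddCommGroup M] [Module k M]
    [AddCommGroup N] [Module k N] (f : M →ₗ[k] k) (m : M) (n : N) :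
    applyFst k f (m ⊗ₜ[k] n) = f m • n := by simp [applyFst]

variable (G : GaloisContext k A X)

@[simp] lemma galoisV_tmul (α : X →ₐ[k] X ⊗[k] A) (x y : X) :
    galoisV k A X α (x ⊗ₜ y) = (x ⊗ₜ 1) * α y := by simp [galoisV]

lemma V_inj {s t : X ⊗[k] X} (h : galoisV k A X G.α s = galoisV k A X G.α t) : s = t :=
  G.galois.1 h

lemma V_beta (a : A) : galoisV k A X G.α (G.β a) = 1 ⊗ₜ a := by
  change G.V (G.V.symm _) = _
  simp

lemma mul_eq_V (t : X ⊗[k] X) :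
    LinearMap.mul' k X t = applySnd k (counit (R := k) (A := A)) (galoisV k A X G.α t) := by
  induction t with
  | zero => simp
  | add x y hx hy => simp only [map_add, hx, hy]
  | tmul x y =>
    have : ∀ s : X ⊗[k] A, applySnd k (counit (R := k) (A := A)) ((x ⊗ₜ 1) * s)
        = x * applySnd k (counit (R := k) (A := A)) s := by
      intro s
      induction s with
      | zero => simp
      | add x y hx hy => simp only [map_add, mul_add, hx, hy]
      | tmul p q => simp
    simp [this, G.counit_id]

lemma mul_beta (a : A) : LinearMap.mul' k X (G.β a) = counit (R := k) a • (1 : X) := by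
  rw [mul_eq_V G, V_beta]; simp

lemma beta_one : G.β 1 = 1 ⊗ₜ 1 := by
  apply V_inj G
  rw [V_beta]; simp [Algebra.TensorProduct.one_def]

/-- Product on `Xᵐᵒᵖ ⊗ X`, reversed: `P (x ⊗ y) (p ⊗ q) = p x ⊗ y q`. -/
noncomputable def Pm (k X : Type*) [Field k] [Ring X] [Algebra k X] :
    X ⊗[k] X →ₗ[k] X ⊗[k] X →ₗ[k] X ⊗[k] X :=
  TensorProduct.homTensorHomMap (RingHom.id k) X X X X ∘ₗ
    TensorProduct.map (LinearMap.mul k X).flip (LinearMap.mul k X)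

@[simp] lemma Pm_tmul (x y p q : X) :
    Pm k X (x ⊗ₜ y) (p ⊗ₜ q) = (p * x) ⊗ₜ (y * q) := by simp [Pm]

lemma V_Pm (s : X ⊗[k] X) (p q : X) :
    galoisV k A X G.α (Pm k X s (p ⊗ₜ q)) = (p ⊗ₜ 1) * galoisV k A X G.α s * G.α q := by
  induction s with
  | zero => simp
  | add x y hx hy => simp only [map_add, LinearMap.add_apply, mul_add, add_mul, hx, hy]
  | tmul x y =>
    simp only [Pm_tmul, galoisV_tmul, map_mul, ← mul_assoc]
    simp

lemma V_Pm_beta (a : A) (t : X ⊗[k] X) :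
    galoisV k A X G.α (Pm k X (G.β a) t) = (1 ⊗ₜ a) * galoisV k A X G.α t := by
  induction t with
  | zero => simp
  | add x y hx hy => simp only [map_add, mul_add, hx, hy]
  | tmul p q =>
    rw [V_Pm, V_beta, galoisV_tmul, ← mul_assoc]
    simp

lemma beta_mul (a b : A) : Pm k X (G.β a) (G.β b) = G.β (a * b) := by
  apply V_inj G
  rw [V_Pm_beta, V_beta, V_beta]; simp

/-- `α(x)(y ⊗ 1)` -/
noncomputable def Wm : X ⊗[k] X →ₗ[k] X ⊗[k] A :=
  LinearMap.mul' k (X ⊗[k] A) ∘ₗ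
    TensorProduct.map G.α.toLinearMap ((TensorProduct.mk k X A).flip 1)

/-- `α(x)(1 ⊗ S d)` -/
noncomputable def Qm : X ⊗[k] A →ₗ[k] X ⊗[k] A :=
  LinearMap.mul' k (X ⊗[k] A) ∘ₗ
    TensorProduct.map G.α.toLinearMap (TensorProduct.mk k X A 1 ∘ₗ S)

lemma Qm_alpha (y : X) : Qm G (G.α y) = y ⊗ₜ 1 := by
  have h1 : ∀ s : X ⊗[k] A, Qm G s
      = LinearMap.lTensor X (LinearMap.mul' k A ∘ₗ LinearMap.lTensor A S)
        (TensorProduct.assoc k X A A (LinearMap.rTensor A G.α.toLinearMap s)) := by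
    intro s
    induction s with
    | zero => simp
    | add x y hx hy => simp only [map_add, hx, hy]
    | tmul p q =>
      simp only [Qm, LinearMap.comp_apply, TensorProduct.map_tmul, LinearMap.rTensor_tmul,
        AlgHom.toLinearMap_apply, LinearMap.mul'_apply, TensorProduct.mk_apply]
      generalize G.α p = t
      induction t with
      | zero => simp
      | add x y hx hy => simp only [map_add, add_mul, TensorProduct.add_tmul, hx, hy]
      | tmul u v => simp
  rw [h1, G.coassoc]
  rw [← LinearMap.comp_apply, ← LinearMap.lTensor_comp, LinearMap.comp_assoc,
    HopfAlgebra.mul_antipode_lTensor_comul]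
  conv_rhs => rw [← G.counit_id y]
  generalize G.α y = t
  induction t with
  | zero => simp
  | add x y hx hy => simp only [map_add, TensorProduct.add_tmul, hx, hy]
  | tmul u v => simp [Algebra.algebraMap_eq_smul_one, smul_tmul]

lemma Qm_V (t : X ⊗[k] X) : Qm G (galoisV k A X G.α t) = Wm G t := by
  have h : ∀ (x : X) (s : X ⊗[k] A), Qm G ((x ⊗ₜ 1) * s) = G.α x * Qm G s := by
    intro x s
    induction s with
    | zero => simp
    | add x y hx hy => simp only [map_add, mul_add, hx, hy]
    | tmul u v => simp [Qm, mul_assoc]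
  induction t with
  | zero => simp
  | add x y hx hy => simp only [map_add, hx, hy]
  | tmul x y => rw [galoisV_tmul, h, Qm_alpha]; simp [Wm]

lemma Wm_beta (a : A) : Wm G (G.β a) = 1 ⊗ₜ S a := by
  rw [← Qm_V, V_beta]; simp [Qm]


lemma star1' {φX : X →ₗ[k] k}
    (hφX : ∀ x : X, applySnd k G.φ (G.α x) = φX x • (1 : X)) (x : X) (t : X ⊗[k] X) : applySnd k G.φ (galoisV k A X G.α t * G.α x)
    = applySnd k (φX ∘ₗ LinearMap.mulRight k x) t := by
  have h : ∀ (p : X) (s : X ⊗[k] A), applySnd k G.φ ((p ⊗ₜ 1) * s) = p * applySnd k G.φ s := by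
    intro p s
    induction s with
    | zero => simp
    | add x y hx hy => simp only [map_add, mul_add, hx, hy]
    | tmul u v => simp
  induction t with
  | zero => simp
  | add x y hx hy => simp only [map_add, add_mul, hx, hy]
  | tmul p q =>
    rw [galoisV_tmul, mul_assoc, ← map_mul, h, hφX]; simp

lemma star2' {φX : X →ₗ[k] k}
    (hφX : ∀ x : X, applySnd k G.φ (G.α x) = φX x • (1 : X)) (x : X) (t : X ⊗[k] X) : applySnd k G.φ (G.α x * Wm G t)
    = applyFst k (φX ∘ₗ LinearMap.mulLeft k x) t := by
  have h : ∀ (p : X) (s : X ⊗[k] A), applySnd k G.φ (s * (p ⊗ₜ 1)) = applySnd k G.φ s * p := by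
    intro p s
    induction s with
    | zero => simp
    | add x y hx hy => simp only [map_add, add_mul, hx, hy]
    | tmul u v => simp
  induction t with
  | zero => simp
  | add x y hx hy => simp only [map_add, mul_add, hx, hy]
  | tmul p q =>
    simp only [Wm, LinearMap.comp_apply, TensorProduct.map_tmul, LinearMap.mul'_apply,
      AlgHom.toLinearMap_apply, LinearMap.flip_apply, TensorProduct.mk_apply]
    rw [← mul_assoc, ← map_mul, h, hφX]; simp


/-- `B = assoc ∘ (β ⊗ id)`. -/
noncomputable def Bm : A ⊗[k] A →ₗ[k] X ⊗[k] (X ⊗[k] A) :=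
  (TensorProduct.assoc k X X A).toLinearMap ∘ₗ LinearMap.rTensor A G.β

lemma alpha_beta (a : A) : LinearMap.lTensor X G.α.toLinearMap (G.β a) = Bm G (comul a) := by
  have key : ∀ t : X ⊗[k] X,
      LinearMap.rTensor A (galoisV k A X G.α)
        ((TensorProduct.assoc k X X A).symm (LinearMap.lTensor X G.α.toLinearMap t))
      = (TensorProduct.assoc k X A A).symm
        (LinearMap.lTensor X (comul (R := k) (A := A)) (galoisV k A X G.α t)) := by
    intro t
    induction t with
    | zero => simp
    | add x y hx hy => simp only [map_add, hx, hy]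
    | tmul x y =>
      have h1 : ∀ s : X ⊗[k] A, LinearMap.rTensor A (galoisV k A X G.α)
          ((TensorProduct.assoc k X X A).symm (x ⊗ₜ s))
          = ((x ⊗ₜ 1) ⊗ₜ 1) * LinearMap.rTensor A G.α.toLinearMap s := by
        intro s
        induction s with
        | zero => simp
        | add x y hx hy => simp only [map_add, mul_add, TensorProduct.tmul_add, hx, hy]
        | tmul u v => simp
      have h2 : ∀ s : X ⊗[k] A, (TensorProduct.assoc k X A A).symm
          (LinearMap.lTensor X (comul (R := k) (A := A)) ((x ⊗ₜ 1) * s))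
          = ((x ⊗ₜ 1) ⊗ₜ 1) * (TensorProduct.assoc k X A A).symm
            (LinearMap.lTensor X (comul (R := k) (A := A)) s) := by
        intro s
        induction s with
        | zero => simp
        | add x y hx hy => simp only [map_add, mul_add, hx, hy]
        | tmul u v =>
          simp only [Algebra.TensorProduct.tmul_mul_tmul, one_mul, LinearMap.lTensor_tmul]
          generalize (comul v : A ⊗[k] A) = w
          induction w with
          | zero => simp
          | add x y hx hy => simp only [map_add, mul_add, TensorProduct.tmul_add, hx, hy]
          | tmul u v => simp
      rw [LinearMap.lTensor_tmul, galoisV_tmul, h2, ← G.coassoc]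
      simp [h1]
  have inj : Function.Injective (LinearMap.rTensor A (galoisV k A X G.α)) :=
    Module.Flat.rTensor_preserves_injective_linearMap _ G.galois.1
  apply (TensorProduct.assoc k X X A).symm.injective
  apply inj
  rw [key, V_beta]
  simp only [Bm, LinearMap.comp_apply, LinearEquiv.coe_coe, LinearEquiv.symm_apply_apply,
    LinearMap.lTensor_tmul]
  generalize (comul a : A ⊗[k] A) = w
  induction w with
  | zero => simp
  | add x y hx hy => simp only [map_add, TensorProduct.tmul_add, hx, hy]
  | tmul u v => simp [V_beta]

/-- `J (y ⊗ a) = a^[1] ⊗ y a^[2]`. -/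
noncomputable def Jm : X ⊗[k] A →ₗ[k] X ⊗[k] X :=
  TensorProduct.lift (LinearMap.lcomp k _ G.β ∘ₗ LinearMap.lTensorHom X ∘ₗ LinearMap.mul k X)

lemma Jm_tmul (y : X) (a : A) :
    Jm G (y ⊗ₜ a) = LinearMap.lTensor X (LinearMap.mulLeft k y) (G.β a) := by
  simp [Jm]; rfl

/-- `K (y ⊗ w) = (1 ⊗ y ⊗ 1) B(w)`. -/
noncomputable def Km : X ⊗[k] (A ⊗[k] A) →ₗ[k] X ⊗[k] (X ⊗[k] A) :=
  TensorProduct.lift (LinearMap.lcomp k _ (Bm G) ∘ₗ LinearMap.lTensorHom X ∘ₗ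
    LinearMap.mul k (X ⊗[k] A) ∘ₗ (TensorProduct.mk k X A).flip 1)

lemma Km_tmul (y : X) (w : A ⊗[k] A) :
    Km G (y ⊗ₜ w) = LinearMap.lTensor X (LinearMap.mulLeft k (y ⊗ₜ (1 : A))) (Bm G w) := by
  simp [Km]; rfl

/-- `R (y ⊗ a) = S(a)^[1] ⊗ y S(a)^[2]`. -/
noncomputable def Rm : X ⊗[k] A →ₗ[k] X ⊗[k] X := Jm G ∘ₗ LinearMap.lTensor X S

lemma Rm_tmul (y : X) (a : A) :
    Rm G (y ⊗ₜ a) = LinearMap.lTensor X (LinearMap.mulLeft k y) (G.β (S a)) := by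
  simp [Rm, Jm_tmul]

lemma Bm_mul (y : X) (c : A) (w : A ⊗[k] A) :
    LinearMap.lTensor X (LinearMap.mulLeft k (y ⊗ₜ c)) (Bm G w)
      = LinearMap.lTensor X (LinearMap.mulLeft k (y ⊗ₜ (1 : A))) (Bm G ((1 ⊗ₜ c) * w)) := by
  induction w with
  | zero => simp
  | add x y hx hy => simp only [map_add, mul_add, hx, hy]
  | tmul u v =>
    simp only [Bm, Algebra.TensorProduct.tmul_mul_tmul, one_mul, LinearMap.comp_apply,
      LinearMap.rTensor_tmul, LinearEquiv.coe_coe]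
    generalize G.β u = t
    induction t with
    | zero => simp
    | add x y hx hy => simp only [map_add, TensorProduct.add_tmul, hx, hy]
    | tmul u v => simp

lemma alpha_Rm (s : X ⊗[k] A) : LinearMap.lTensor X G.α.toLinearMap (Rm G s)
    = Km G (LinearMap.lTensor X (hMap k A)
        (TensorProduct.assoc k X A A (LinearMap.rTensor A G.α.toLinearMap s))) := by
  induction s with
  | zero => simp
  | add x y hx hy => simp only [map_add, hx, hy]
  | tmul y a =>
    have h1 : ∀ t : X ⊗[k] X, LinearMap.lTensor X G.α.toLinearMap
        (LinearMap.lTensor X (LinearMap.mulLeft k y) t)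
        = LinearMap.lTensor X (LinearMap.mulLeft k (G.α y))
          (LinearMap.lTensor X G.α.toLinearMap t) := by
      intro t
      induction t with
      | zero => simp
      | add x y hx hy => simp only [map_add, hx, hy]
      | tmul u v => simp
    rw [Rm_tmul, h1, alpha_beta, LinearMap.rTensor_tmul, AlgHom.toLinearMap_apply]
    generalize G.α y = t
    induction t with
    | zero => simp
    | add x y hx hy =>
      have : LinearMap.mulLeft k (x + y) = LinearMap.mulLeft k x + LinearMap.mulLeft k y := by
        ext; simp [add_mul]
      simp only [map_add, TensorProduct.add_tmul, this, LinearMap.lTensor_add,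
        LinearMap.add_apply, hx, hy]
    | tmul u v =>
      rw [Bm_mul]
      simp [Km_tmul, hMap]

lemma Rm_coinv (x : X) : LinearMap.lTensor X G.α.toLinearMap (Rm G (G.α x))
    = TensorProduct.assoc k X X A (Rm G (G.α x) ⊗ₜ 1) := by
  rw [alpha_Rm, G.coassoc]
  generalize G.α x = s
  induction s with
  | zero => simp
  | add x y hx hy => simp only [map_add, TensorProduct.add_tmul, hx, hy]
  | tmul y a =>
    simp only [LinearMap.lTensor_tmul, hMap_comul, Km_tmul, Rm_tmul, Bm, LinearMap.comp_apply,
      LinearMap.rTensor_tmul, LinearEquiv.coe_coe]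
    generalize G.β (S a) = t
    induction t with
    | zero => simp
    | add x y hx hy => simp only [map_add, TensorProduct.add_tmul, hx, hy]
    | tmul u v => simp

lemma coinv_tensor (u : X ⊗[k] X) (h : LinearMap.lTensor X G.α.toLinearMap u
    = TensorProduct.assoc k X X A (u ⊗ₜ 1)) : u = LinearMap.mul' k X u ⊗ₜ 1 := by
  have hf : ∀ f : X →ₗ[k] k, ∃ c : k, applyFst k f u = c • (1 : X) := by
    intro f
    apply G.coinv_trivial
    have h1 : ∀ t : X ⊗[k] X, G.α (applyFst k f t)
        = applyFst k f (LinearMap.lTensor X G.α.toLinearMap t) := by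
      intro t
      induction t with
      | zero => simp
      | add x y hx hy => simp only [map_add, hx, hy]
      | tmul u v => simp
    have h2 : ∀ t : X ⊗[k] X, applyFst k f (TensorProduct.assoc k X X A (t ⊗ₜ 1))
        = applyFst k f t ⊗ₜ (1 : A) := by
      intro t
      induction t with
      | zero => simp
      | add x y hx hy => simp only [map_add, TensorProduct.add_tmul, hx, hy]
      | tmul u v => simp [smul_tmul']
    rw [h1, h, h2]
  have hm : ∃ m : X, u = m ⊗ₜ 1 := by
    classical
    let b := Module.Basis.ofVectorSpace k X
    choose c hc using fun i => hf (b.coord i)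
    have h3 := (TensorProduct.equivFinsuppOfBasisLeft (N := X) b).symm_apply_apply u
    rw [TensorProduct.equivFinsuppOfBasisLeft_symm_apply] at h3
    refine ⟨∑ i ∈ (TensorProduct.equivFinsuppOfBasisLeft (N := X) b u).support, c i • b i, ?_⟩
    refine h3.symm.trans ?_
    rw [Finsupp.sum, TensorProduct.sum_tmul]
    refine Finset.sum_congr rfl fun i _ => ?_
    rw [TensorProduct.equivFinsuppOfBasisLeft_apply]
    have := hc i
    simp only [applyFst, LinearMap.comp_apply, LinearEquiv.coe_coe] at this
    rw [this, smul_tmul]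
  obtain ⟨m, rfl⟩ := hm
  simp

/-- The Grunspan map `Θ(x) = S(x₁)^[1] x₀ S(x₁)^[2]`. -/
noncomputable def Theta : X →ₗ[k] X := LinearMap.mul' k X ∘ₗ Rm G ∘ₗ G.α.toLinearMap

lemma Rm_alpha (x : X) : Rm G (G.α x) = Theta G x ⊗ₜ 1 :=
  coinv_tensor G _ (Rm_coinv G x)

lemma Rm_V (t : X ⊗[k] X) : Rm G (galoisV k A X G.α t)
    = TensorProduct.map (Theta G) LinearMap.id (TensorProduct.comm k X X t) := by
  have h : ∀ (p : X) (s : X ⊗[k] A), Rm G ((p ⊗ₜ 1) * s)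
      = LinearMap.lTensor X (LinearMap.mulLeft k p) (Rm G s) := by
    intro p s
    induction s with
    | zero => simp
    | add x y hx hy => simp only [map_add, mul_add, hx, hy]
    | tmul u v =>
      simp only [Algebra.TensorProduct.tmul_mul_tmul, one_mul, Rm_tmul,
        LinearMap.mulLeft_mul, LinearMap.lTensor_comp, LinearMap.comp_apply]
  induction t with
  | zero => simp
  | add x y hx hy => simp only [map_add, hx, hy]
  | tmul p q => rw [galoisV_tmul, h, Rm_alpha]; simp

lemma beta_S (a : A) : G.β (S a)
    = TensorProduct.map (Theta G) LinearMap.id (TensorProduct.comm k X X (G.β a)) := by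
  rw [← Rm_V, V_beta, Rm_tmul]
  simp

lemma part_two (x : X) :
      (TensorProduct.map (LinearMap.mul' k X ∘ₗ (TensorProduct.comm k X X).toLinearMap)
          LinearMap.id ∘ₗ
        (TensorProduct.assoc k X X X).symm.toLinearMap ∘ₗ
          TensorProduct.map (Theta G) G.β) (G.α x)
        = (1 : X) ⊗ₜ[k] x := by
  have h1 : ∀ s : X ⊗[k] A,
      (TensorProduct.map (LinearMap.mul' k X ∘ₗ (TensorProduct.comm k X X).toLinearMap)
          LinearMap.id ∘ₗ
        (TensorProduct.assoc k X X X).symm.toLinearMap ∘ₗ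
          TensorProduct.map (Theta G) G.β) s
      = Jm G (LinearMap.lTensor X (LinearMap.mul' k A ∘ₗ LinearMap.rTensor A S)
        (TensorProduct.assoc k X A A (LinearMap.rTensor A G.α.toLinearMap s))) := by
    intro s
    induction s with
    | zero => simp
    | add x y hx hy => simp only [map_add, hx, hy]
    | tmul y a =>
      have e1 : ∀ t : X ⊗[k] X,
          (TensorProduct.map (LinearMap.mul' k X ∘ₗ (TensorProduct.comm k X X).toLinearMap)
          LinearMap.id) ((TensorProduct.assoc k X X X).symm (Theta G y ⊗ₜ t))
          = Pm k X (Theta G y ⊗ₜ 1) t := by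
        intro t
        induction t with
        | zero => simp
        | add x y hx hy => simp only [map_add, TensorProduct.tmul_add, hx, hy]
        | tmul u v => simp
      simp only [LinearMap.comp_apply, LinearEquiv.coe_coe, TensorProduct.map_tmul,
        LinearMap.rTensor_tmul, AlgHom.toLinearMap_apply]
      have e1' := e1 (G.β a)
      rw [e1', ← Rm_alpha]
      generalize G.α y = r
      induction r with
      | zero => simp
      | add x y hx hy =>
        simp only [map_add, TensorProduct.add_tmul, LinearMap.add_apply, hx, hy]
      | tmul u c =>
        have e2 : ∀ s t : X ⊗[k] X,
            Pm k X (LinearMap.lTensor X (LinearMap.mulLeft k u) s) t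
            = LinearMap.lTensor X (LinearMap.mulLeft k u) (Pm k X s t) := by
          intro s t
          induction s with
          | zero => simp
          | add x y hx hy => simp only [map_add, LinearMap.add_apply, hx, hy]
          | tmul p q =>
            induction t with
            | zero => simp
            | add x y hx hy => simp only [map_add, hx, hy]
            | tmul v w => simp [mul_assoc]
        rw [Rm_tmul, e2, beta_mul]
        simp [Jm_tmul]
  rw [h1, G.coassoc, ← LinearMap.comp_apply (LinearMap.lTensor X _), ← LinearMap.lTensor_comp,
    LinearMap.comp_assoc, HopfAlgebra.mul_antipode_rTensor_comul]
  conv_rhs => rw [← G.counit_id x]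
  generalize G.α x = t
  induction t with
  | zero => simp
  | add x y hx hy => simp only [map_add, TensorProduct.tmul_add, hx, hy]
  | tmul u v =>
    simp [Jm_tmul, Algebra.algebraMap_eq_smul_one, beta_one]

section Modular

variable (χ : A →ₐ[k] k)

lemma char_conv_left :
    toConv (χ.toLinearMap ∘ₗ S) * toConv χ.toLinearMap = 1 := by
  have := LinearMap.algHom_comp_convMul_distrib χ (toConv S) (toConv LinearMap.id)
  rw [LinearMap.antipode_mul_id] at this
  simp only [LinearMap.comp_id] at this
  apply WithConv.ofConv_injective
  rw [← this]
  ext a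
  simp

lemma char_conv_right :
    toConv χ.toLinearMap * toConv (χ.toLinearMap ∘ₗ S) = 1 := by
  have := LinearMap.algHom_comp_convMul_distrib χ (toConv LinearMap.id) (toConv S)
  rw [LinearMap.id_mul_antipode] at this
  simp only [LinearMap.comp_id] at this
  apply WithConv.ofConv_injective
  rw [← this]
  ext a
  simp

/-- `L_χ(a) = χ(a₁) a₂`. -/
noncomputable def Lm : A →ₐ[k] A :=
  (Algebra.TensorProduct.lid k A).toAlgHom.comp
    ((Algebra.TensorProduct.map χ (AlgHom.id k A)).comp (Bialgebra.comulAlgHom k A))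

lemma Lm_apply (a : A) : Lm χ a = applyFst k χ.toLinearMap (comul a) := by
  simp only [Lm, AlgHom.comp_apply, Bialgebra.comulAlgHom_apply]
  generalize (comul a : A ⊗[k] A) = t
  induction t with
  | zero => simp
  | add x y hx hy => simp only [map_add, hx, hy]
  | tmul u v => simp

lemma counit_Lm (a : A) : counit (R := k) (Lm χ a) = χ a := by
  have h : ∀ t : A ⊗[k] A, counit (R := k) (applyFst k χ.toLinearMap t)
      = χ (applySnd k (counit (R := k) (A := A)) t) := by
    intro t
    induction t with
    | zero => simp
    | add x y hx hy => simp only [map_add, hx, hy]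
    | tmul u v => simp [mul_comm]
  rw [Lm_apply, h]
  simp [applySnd]

lemma Lm_surj (b : A) : ∃ b', Lm χ b' = b := by
  refine ⟨applyFst k (χ.toLinearMap ∘ₗ S) (comul b), ?_⟩
  have h1 : ∀ t : A ⊗[k] A, Lm χ (applyFst k (χ.toLinearMap ∘ₗ S) t)
      = applyFst k (χ.toLinearMap ∘ₗ S)
        (LinearMap.lTensor A (applyFst k χ.toLinearMap)
          (LinearMap.lTensor A (comul (R := k) (A := A)) t)) := by
    intro t
    induction t with
    | zero => simp
    | add x y hx hy => simp only [map_add, hx, hy]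
    | tmul u v => simp [Lm_apply]
  have h2 : ∀ t : (A ⊗[k] A) ⊗[k] A, applyFst k (χ.toLinearMap ∘ₗ S)
        (LinearMap.lTensor A (applyFst k χ.toLinearMap) (TensorProduct.assoc k A A A t))
      = applyFst k (LinearMap.mul' k k ∘ₗ
          TensorProduct.map (χ.toLinearMap ∘ₗ S) χ.toLinearMap) t := by
    intro t
    induction t with
    | zero => simp
    | add x y hx hy => simp only [map_add, hx, hy]
    | tmul u v =>
      induction u with
      | zero => simp
      | add x y hx hy => simp only [map_add, TensorProduct.add_tmul, hx, hy]
      | tmul u w => simp [smul_smul, mul_comm]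
  have h3 : ∀ t : A ⊗[k] A, applyFst k (LinearMap.mul' k k ∘ₗ
          TensorProduct.map (χ.toLinearMap ∘ₗ S) χ.toLinearMap)
          (LinearMap.rTensor A (comul (R := k) (A := A)) t)
        = applyFst k (counit (R := k) (A := A)) t := by
    intro t
    induction t with
    | zero => simp
    | add x y hx hy => simp only [map_add, hx, hy]
    | tmul u v =>
      have := congrArg (fun f => f.ofConv u) (char_conv_left (k := k) χ)
      simp only [LinearMap.convMul_apply, LinearMap.convOne_apply] at this
      simp only [LinearMap.rTensor_tmul, applyFst_tmul, LinearMap.comp_apply]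
      rw [this]
      simp
  rw [h1, ← Coalgebra.coassoc_apply, h2, h3]
  simp [applyFst]

lemma phi_Lm (a : A) : G.φ (Lm χ a) = G.φ a := by
  have h : ∀ t : A ⊗[k] A, G.φ (applyFst k χ.toLinearMap t) = χ (applySnd k G.φ t) := by
    intro t
    induction t with
    | zero => simp
    | add x y hx hy => simp only [map_add, hx, hy]
    | tmul u v => simp [mul_comm]
  rw [Lm_apply, h, G.φ_integral]
  simp

lemma sigma_Lm (σ : A ≃ₐ[k] A) (hσ : ∀ a b : A, G.φ (a * b) = G.φ (b * σ a)) (a : A) :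
    σ (Lm χ a) = Lm χ (σ a) := by
  rw [← sub_eq_zero]
  apply G.φ_faithful_right
  intro b
  obtain ⟨b', rfl⟩ := Lm_surj χ b
  rw [mul_sub, map_sub, ← hσ, ← map_mul, ← map_mul, phi_Lm, phi_Lm, hσ, sub_self]

lemma char_inv (σ : A ≃ₐ[k] A) (hσ : ∀ a b : A, G.φ (a * b) = G.φ (b * σ a)) :
    toConv (counit (R := k) (A := A) ∘ₗ σ.toLinearMap) *
      toConv (counit (R := k) (A := A) ∘ₗ σ.symm.toLinearMap) = 1 := by
  let χ : A →ₐ[k] k := (Bialgebra.counitAlgHom k A).comp σ.symm.toAlgHom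
  have hχ : χ.toLinearMap = counit (R := k) (A := A) ∘ₗ σ.symm.toLinearMap := rfl
  have h1 : toConv χ.toLinearMap * toConv (counit (R := k) (A := A) ∘ₗ σ.toLinearMap) = 1 := by
    ext a
    rw [LinearMap.convMul_apply, LinearMap.convOne_apply]
    have h : ∀ t : A ⊗[k] A, LinearMap.mul' k k (TensorProduct.map χ.toLinearMap
        (counit (R := k) (A := A) ∘ₗ σ.toLinearMap) t)
        = counit (R := k) (σ (applyFst k χ.toLinearMap t)) := by
      intro t
      induction t with
      | zero => simp
      | add x y hx hy => simp only [map_add, hx, hy]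
      | tmul u v => simp
    refine (h _).trans ?_
    rw [← Lm_apply, sigma_Lm G χ σ hσ, counit_Lm]
    simp [χ]
  rw [← hχ]
  have h2 : toConv (counit (R := k) (A := A) ∘ₗ σ.toLinearMap)
      = toConv (χ.toLinearMap ∘ₗ S) := by
    rw [← one_mul (toConv (counit (R := k) (A := A) ∘ₗ σ.toLinearMap)),
      ← char_conv_left χ, mul_assoc, h1, mul_one]
  rw [h2, char_conv_left]

end Modular

section Final

variable {φX : X →ₗ[k] k} {σ : A ≃ₐ[k] A} {σX : X ≃ₐ[k] X}

lemma alpha_sigmaX (hφX : ∀ x : X, applySnd k G.φ (G.α x) = φX x • (1 : X))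
    (hσ : ∀ a b : A, G.φ (a * b) = G.φ (b * σ a))
    (hσX : ∀ x y : X, φX (y * σX x) = φX (x * y)) (x : X) :
    G.α (σX x) = TensorProduct.map (Theta G) σ.toLinearMap (G.α x) := by
  have key : ∀ b : A, applySnd k G.φ ((1 ⊗ₜ b) * G.α (σX x))
      = applySnd k G.φ ((1 ⊗ₜ b) * TensorProduct.map (Theta G) σ.toLinearMap (G.α x)) := by
    intro b
    obtain ⟨c, rfl⟩ := G.antipode_bijective.2 b
    have h1 : ∀ t : X ⊗[k] X, applySnd k (φX ∘ₗ LinearMap.mulRight k (σX x))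
        (TensorProduct.map (Theta G) LinearMap.id (TensorProduct.comm k X X t))
        = Theta G (applyFst k (φX ∘ₗ LinearMap.mulLeft k x) t) := by
      intro t
      induction t with
      | zero => simp
      | add x y hx hy => simp only [map_add, hx, hy]
      | tmul u v => simp [hσX]
    have h2 : ∀ s : X ⊗[k] A, Theta G (applySnd k G.φ (s * (1 ⊗ₜ S c)))
        = applySnd k G.φ ((1 ⊗ₜ S c) * TensorProduct.map (Theta G) σ.toLinearMap s) := by
      intro s
      induction s with
      | zero => simp
      | add x y hx hy => simp only [map_add, mul_add, add_mul, hx, hy]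
      | tmul u v => simp [hσ v]
    rw [← V_beta G, star1' G hφX, beta_S, h1, ← star2' G hφX, Wm_beta, h2, ← beta_S, V_beta]
  have h3 : ∀ (f : X →ₗ[k] k) (b : A) (u : X ⊗[k] A),
      G.φ (b * applyFst k f u) = f (applySnd k G.φ ((1 ⊗ₜ b) * u)) := by
    intro f b u
    induction u with
    | zero => simp
    | add x y hx hy => simp only [map_add, mul_add, hx, hy]
    | tmul u v => simp [mul_comm]
  apply tensor_eq_of_applyFst
  intro f
  rw [← sub_eq_zero]
  apply G.φ_faithful_right
  intro b
  rw [mul_sub, map_sub, h3, h3, key, sub_self]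

lemma thetaX_eq (hφX : ∀ x : X, applySnd k G.φ (G.α x) = φX x • (1 : X))
    (hσ : ∀ a b : A, G.φ (a * b) = G.φ (b * σ a))
    (hσX : ∀ x y : X, φX (y * σX x) = φX (x * y)) :
    thetaX G σ σX = Theta G := by
  have h1 : ∀ y : X, σX y
      = Theta G (applySnd k (counit (R := k) (A := A) ∘ₗ σ.toLinearMap) (G.α y)) := by
    intro y
    have h : ∀ s : X ⊗[k] A, applySnd k (counit (R := k) (A := A))
        (TensorProduct.map (Theta G) σ.toLinearMap s)
        = Theta G (applySnd k (counit (R := k) (A := A) ∘ₗ σ.toLinearMap) s) := by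
      intro s
      induction s with
      | zero => simp
      | add x y hx hy => simp only [map_add, hx, hy]
      | tmul u v => simp
    rw [← h, ← alpha_sigmaX G hφX hσ hσX, G.counit_id]
  have hc := char_inv G σ hσ
  ext x
  simp only [thetaX, LinearMap.comp_apply, AlgEquiv.toLinearMap_apply, AlgHom.toLinearMap_apply]
  rw [h1]
  congr 1
  have h2 : ∀ s : X ⊗[k] A,
      applySnd k (counit (R := k) (A := A) ∘ₗ σ.toLinearMap)
        (G.α (applySnd k (counit (R := k) (A := A) ∘ₗ σ.symm.toLinearMap) s))
      = applySnd k (LinearMap.mul' k k ∘ₗ TensorProduct.map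
          (counit (R := k) (A := A) ∘ₗ σ.toLinearMap)
          (counit (R := k) (A := A) ∘ₗ σ.symm.toLinearMap))
        (TensorProduct.assoc k X A A (LinearMap.rTensor A G.α.toLinearMap s)) := by
    intro s
    induction s with
    | zero => simp
    | add x y hx hy => simp only [map_add, hx, hy]
    | tmul y a =>
      simp only [applySnd_tmul, LinearMap.rTensor_tmul, map_smul, AlgHom.toLinearMap_apply]
      generalize G.α y = t
      induction t with
      | zero => simp
      | add x y hx hy => simp only [map_add, smul_add, TensorProduct.add_tmul, hx, hy]
      | tmul u v => simp [smul_smul, mul_comm]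
  rw [h2, G.coassoc]
  conv_rhs => rw [← G.counit_id x]
  generalize G.α x = t
  induction t with
  | zero => simp
  | add x y hx hy => simp only [map_add, hx, hy]
  | tmul u v =>
    have := congrArg (fun f => f.ofConv v) hc
    simp only [LinearMap.convMul_apply, LinearMap.convOne_apply] at this
    simp only [LinearMap.lTensor_tmul, applySnd_tmul]
    rw [LinearMap.comp_apply, this]
    simp

end Final

end Helpers

theorem galois_object_thetaX_antipode_formulas
    {k : Type*} [Field k] {A X : Type*} [Ring A] [HopfAlgebra k A]
    [Ring X] [Algebra k X] [Nontrivial X]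
    (G : GaloisContext k A X)
    (φX : X →ₗ[k] k)
    (hφX : ∀ x : X, applySnd k G.φ (G.α x) = φX x • (1 : X))
    (σ : A ≃ₐ[k] A) (hσ : ∀ a b : A, G.φ (a * b) = G.φ (b * σ a))
    (σX : X ≃ₐ[k] X) (hσX : ∀ x y : X, φX (y * σX x) = φX (x * y)) :
    (∀ a : A,
      G.β (HopfAlgebra.antipode (R := k) (A := A) a)
        = TensorProduct.map (thetaX G σ σX) LinearMap.id
            (TensorProduct.comm k X X (G.β a))) ∧
    (∀ x : X,
      (TensorProduct.map (LinearMap.mul' k X ∘ₗ (TensorProduct.comm k X X).toLinearMap)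
          LinearMap.id ∘ₗ
        (TensorProduct.assoc k X X X).symm.toLinearMap ∘ₗ
          TensorProduct.map (thetaX G σ σX) G.β) (G.α x)
        = (1 : X) ⊗ₜ[k] x) ∧
    (∀ a : A,
      LinearMap.mul' k X
          (TensorProduct.map (thetaX G σ σX) LinearMap.id
            (TensorProduct.comm k X X (G.β a)))
        = Coalgebra.counit (R := k) a • (1 : X)) ∧
    (∀ a : A,
      G.β (HopfAlgebra.antipode (R := k) (A := A)
            (HopfAlgebra.antipode (R := k) (A := A) a))
        = TensorProduct.map (thetaX G σ σX) (thetaX G σ σX) (G.β a)) := by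
  rw [thetaX_eq G hφX hσ hσX]
  refine ⟨beta_S G, part_two G, fun a => ?_, fun a => ?_⟩
  · rw [← beta_S, mul_beta, HopfAlgebra.counit_antipode]
  · rw [beta_S, beta_S]
    generalize G.β a = t
    induction t with
    | zero => simp
    | add x y hx hy => simp only [map_add, hx, hy]
    | tmul u v => simp
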